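/- arXiv:math/0109140 — 2 statements merged into one kernel-verified Lean document; each statement's English description precedes it below -/
import Mathlib

section
/- For every 1 ≤ a ≤ n and every u ∈ ℂ, the fundamental q-character equals the canceling tableau sum over the N letters: T^{(a)}_1(u) = Σ_{1 ≤ i_1 < i_2 < ⋯ < i_a ≤ N} ∏_{k=1}^{a} x_{i_k}(u + a/2 − k). (In particular, all negative contributions arising from x_{n+2} = −x_{n+1} cancel.) -/
attribute [local instance 10] Classical.propDecidable

noncomputable section

open Finset

variable {K : Type*} [CommRing K]

/-- `Y_a(u)` as a unit of `K`, with `Y_0(u) = 1`, where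
`Y_a(u) = Q_a(u - d_a) Q_a(u + d_a)⁻¹`, `d_a = 1/2` for `a < n` and `d_n = 1`. -/
def Yq (n : ℕ) (Q : ℕ → ℂ → Kˣ) (a : ℕ) (u : ℂ) : Kˣ :=
  if a = 0 then 1
  else Q a (u - (if a = n then 1 else 2⁻¹)) * (Q a (u + (if a = n then 1 else 2⁻¹)))⁻¹

/-- `z_i(u)` for `i = 1,…,2n`, where `i ≤ n` encodes the letter `i` of the alphabet
`J = {1 ≺ ⋯ ≺ n ≺ n̄ ≺ ⋯ ≺ 1̄}`, and `i > n` encodes the letter `\overline{2n+1-i}`. -/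
def zq (n : ℕ) (Q : ℕ → ℂ → Kˣ) (i : ℕ) (u : ℂ) : Kˣ :=
  if i ≤ n then
    Yq n Q i (u + (i : ℂ) / 2) * (Yq n Q (i - 1) (u + ((i : ℂ) + 1) / 2))⁻¹
  else
    Yq n Q (2 * n - i) (u + ((i : ℂ) + 2) / 2) *
      (Yq n Q (2 * n + 1 - i) (u + ((i : ℂ) + 3) / 2))⁻¹

/-- the common value `x_{n+1}(u) = -x_{n+2}(u)
  = Q_n(u+n/2) Q_n(u+(n+4)/2) Q_n(u+(n+2)/2)⁻²`. -/
def xqmid (n : ℕ) (Q : ℕ → ℂ → Kˣ) (u : ℂ) : K :=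
  (Q n (u + (n : ℂ) / 2) : K) * (Q n (u + ((n : ℂ) + 4) / 2) : K) *
    (((Q n (u + ((n : ℂ) + 2) / 2))⁻¹ : Kˣ) : K) ^ 2

/-- `x_i(u)` for `i = 1,…,N = 2n+2`. -/
def xq (n : ℕ) (Q : ℕ → ℂ → Kˣ) (i : ℕ) (u : ℂ) : K :=
  if i ≤ n then zq n Q i u
  else if i = n + 1 then xqmid n Q u
  else if i = n + 2 then -xqmid n Q u
  else zq n Q (i - 2) u

/-- admissibility of a column tableau: whenever `i_k = c` and `i_l = \bar c`
for some `1 ≤ c ≤ n`, one has `n + k - l ≥ c` (letters encoded as in `zq`,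
positions `0`-based, which does not change the difference `k - l`). -/
def AdmQ (n : ℕ) {a : ℕ} (t : Fin a → Fin (2 * n)) : Prop :=
  ∀ k l : Fin a, ((t k : ℕ) + 1 ≤ n) → ((t l : ℕ) + 1 = 2 * n + 1 - ((t k : ℕ) + 1)) →
    (((t k : ℕ) + 1 : ℤ)) ≤ (n : ℤ) + (k : ℕ) - (l : ℕ)

/-- the column tableau sum: `tabSumQ n Q a v = T^{(a)}_1(v)` for `0 ≤ a ≤ n`, i.e.
`T^{(a)}_1(u + 1/2) = ∑ z_{i_1}(u + (a-1)/2) ⋯ z_{i_a}(u - (a-1)/2)` over strictly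
increasing admissible tableaux. -/
def tabSumQ (n : ℕ) (Q : ℕ → ℂ → Kˣ) (a : ℕ) (v : ℂ) : K :=
  ∑ t ∈ univ.filter (fun t : Fin a → Fin (2 * n) => StrictMono t ∧ AdmQ n t),
    ∏ k : Fin a,
      (zq n Q ((t k : ℕ) + 1) (v + ((a : ℂ) - 2 * (((k : ℕ) : ℂ) + 1)) / 2) : K)

/-- `T^{(a)}_1(v)` for all `a ∈ ℤ`: the fundamental `q`-characters for `1 ≤ a ≤ n`,
extended by `T^{(0)}_1 = 1`, `T^{(a)}_1 = 0` for `a < 0`, and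
`T^{(a)}_1(u) + T^{(N-a)}_1(u) = 0`. -/
def T1q (n : ℕ) (Q : ℕ → ℂ → Kˣ) (a : ℤ) (v : ℂ) : K :=
  if a < 0 then 0
  else if a ≤ (n : ℤ) then tabSumQ n Q a.toNat v
  else if a = (n : ℤ) + 1 then 0
  else if a ≤ 2 * (n : ℤ) + 2 then -tabSumQ n Q (2 * (n : ℤ) + 2 - a).toNat v
  else 0

/-- left-to-right composition of a list of difference operators. -/
def opProd (l : List ((ℂ → K) → (ℂ → K))) : (ℂ → K) → (ℂ → K) :=
  l.foldr (· ∘ ·) id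

/-- the operator `L(u) = (M_{x_1(⋅+n)} - D)(M_{x_2(⋅+n-1)} - D) ⋯ (M_{x_N(⋅+n+1-N)} - D)`,
where `D` is the shift `(Df)(u) = f(u+1)` and `M_g` is multiplication by `g`. -/
def Lq (n : ℕ) (Q : ℕ → ℂ → Kˣ) : (ℂ → K) → (ℂ → K) :=
  opProd ((List.range (2 * n + 2)).map fun j =>
    fun f u => xq n Q (j + 1) (u + (n : ℂ) - (j : ℂ)) * f u - f (u + 1))

/-- `ε_i = -1` for `i = n+1, n+2` and `= 1` otherwise. -/
def epsq (n : ℕ) (i : ℕ) : K := if i = n + 1 ∨ i = n + 2 then -1 else 1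

/-- `L_j`, the left-to-right composition over `i = N+1-j, …, N` of the operators
`D - ε_i M_{x_i(⋅+n+1-i)}`. -/
def Ljq (n : ℕ) (Q : ℕ → ℂ → Kˣ) (j : ℕ) : (ℂ → K) → (ℂ → K) :=
  opProd ((List.range j).map fun r =>
    fun f u => f (u + 1) -
      epsq n (2 * n + 3 - j + r) * xq n Q (2 * n + 3 - j + r)
        (u + (n : ℂ) + 1 - ((2 * n + 3 - j + r : ℕ) : ℂ)) * f u)

/-- the Casorati determinant `det_{1 ≤ r,s ≤ j} (w_r(u + s - 1))`
(for a family `w` indexed by `1, 2, …`). -/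
def casq (w : ℕ → ℂ → K) (j : ℕ) (u : ℂ) : K :=
  Matrix.det (Matrix.of fun r s : Fin j => w ((r : ℕ) + 1) (u + ((s : ℕ) : ℂ)))

/-- `ξ^{(a)}_m(u)`: the determinant of the `N × N` matrix whose columns are
`(w_j(u+c))_j` for `c` running over `(0, 1, …, a-1, a+m, a+m+1, …, N+m-1)`. -/
def xiq (n : ℕ) (w : ℕ → ℂ → K) (a m : ℕ) (u : ℂ) : K :=
  Matrix.det (Matrix.of fun j r : Fin (2 * n + 2) =>
    w ((j : ℕ) + 1) (u + ((if (r : ℕ) < a then (r : ℕ) else (r : ℕ) + m : ℕ) : ℂ)))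

/-- The weight of a column with set of entries `S`, read from the smallest entry down. -/
def colWeight (x : ℕ → ℂ → K) (S : Finset ℕ) (u : ℂ) : K :=
  ∏ i ∈ S, x i (u - ((#{j ∈ S | j < i} : ℕ) : ℂ))

/-- The sum of the weights of the columns of length `d` with entries in `s` satisfying `Ad`. -/
def colSum (x : ℕ → ℂ → K) (Ad : Finset ℕ → Prop) (s : Finset ℕ) (d : ℤ) (u : ℂ) : K :=
  ∑ S ∈ s.powerset, if (#S : ℤ) = d ∧ Ad S then colWeight x S u else 0

theorem colWeight_insert_min (x : ℕ → ℂ → K) (S : Finset ℕ) (a : ℕ) (h : ∀ j ∈ S, a < j)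
    (u : ℂ) : colWeight x (insert a S) u = x a u * colWeight x S (u - 1) := by
  have ha : a ∉ S := fun h' => lt_irrefl _ (h a h')
  unfold colWeight
  rw [prod_insert ha]
  congr 1
  · have : ({j ∈ insert a S | j < a} : Finset ℕ) = ∅ := by
      ext j
      simp only [mem_filter, mem_insert, notMem_empty, iff_false, not_and]
      rintro (rfl | hj)
      · exact lt_irrefl _
      · exact (h j hj).not_gt
    rw [this]; simp
  · refine prod_congr rfl fun i hi => ?_
    have : ({j ∈ insert a S | j < i} : Finset ℕ) = insert a {j ∈ S | j < i} := by
      rw [filter_insert, if_pos (h i hi)]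
    rw [this, card_insert_of_notMem (by simp [ha])]
    congr 1
    push_cast; ring

theorem colWeight_insert_max (x : ℕ → ℂ → K) (S : Finset ℕ) (b : ℕ) (h : ∀ j ∈ S, j < b)
    (u : ℂ) : colWeight x (insert b S) u = colWeight x S u * x b (u - (#S : ℂ)) := by
  have hb : b ∉ S := fun h' => lt_irrefl _ (h b h')
  unfold colWeight
  rw [prod_insert hb, mul_comm]
  congr 1
  · refine prod_congr rfl fun i hi => ?_
    rw [filter_insert, if_neg (h i hi).not_gt]
  · rw [filter_insert, if_neg (lt_irrefl _), filter_true_of_mem h]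

/-- Splitting a column sum according to whether the two extreme letters occur. -/
theorem colSum_insert_insert (x : ℕ → ℂ → K) (Ad : Finset ℕ → Prop) (s : Finset ℕ) (a b : ℕ)
    (hab : a < b) (hs : ∀ j ∈ s, a < j ∧ j < b) (C : ℤ → Prop)
    (hAa : ∀ S ⊆ s, Ad (insert a S) ↔ Ad S) (hAb : ∀ S ⊆ s, Ad (insert b S) ↔ Ad S)
    (hAab : ∀ S ⊆ s, Ad (insert a (insert b S)) ↔ Ad S ∧ C (#S + 2)) (d : ℤ) (u : ℂ) :
    colSum x Ad (insert a (insert b s)) d u =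
      colSum x Ad s d u + x a u * colSum x Ad s (d - 1) (u - 1)
      + colSum x Ad s (d - 1) u * x b (u - (d - 1))
      + if C d then x a u * colSum x Ad s (d - 2) (u - 1) * x b (u - 1 - (d - 2)) else 0 := by
  have hbs : b ∉ s := fun h => lt_irrefl _ (hs b h).2
  have has : a ∉ insert b s := by
    rw [mem_insert, not_or]
    exact ⟨hab.ne, fun h => lt_irrefl _ (hs a h).1⟩
  have key : colSum x Ad s (d - 1) u * x b (u - (d - 1)) =
      ∑ S ∈ s.powerset, if (#(insert b S) : ℤ) = d ∧ Ad (insert b S)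
        then colWeight x (insert b S) u else 0 := by
    unfold colSum
    rw [sum_mul]
    refine sum_congr rfl fun S hS => ?_
    rw [mem_powerset] at hS
    rw [card_insert_of_notMem fun h => hbs (hS h), hAb S hS,
      colWeight_insert_max x S b fun j hj => (hs j (hS hj)).2]
    by_cases h : (#S : ℤ) = d - 1
    · have h' : ((#S : ℕ) : ℂ) = (d : ℂ) - 1 := by exact_mod_cast congrArg (Int.cast : ℤ → ℂ) h
      simp [h, h']
    · have h' : ¬ (#S : ℤ) + 1 = d := by omega
      simp [h, h']
  have key2 : x a u * colSum x Ad s (d - 1) (u - 1) =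
      ∑ S ∈ s.powerset, if (#(insert a S) : ℤ) = d ∧ Ad (insert a S)
        then colWeight x (insert a S) u else 0 := by
    unfold colSum
    rw [mul_sum]
    refine sum_congr rfl fun S hS => ?_
    rw [mem_powerset] at hS
    rw [card_insert_of_notMem fun h => has (mem_insert_of_mem (hS h)), hAa S hS,
      colWeight_insert_min x S a fun j hj => (hs j (hS hj)).1]
    by_cases h : (#S : ℤ) = d - 1
    · simp [h]
    · have h' : ¬ (#S : ℤ) + 1 = d := by omega
      simp [h, h']
  have key3 : (if C d then x a u * colSum x Ad s (d - 2) (u - 1) * x b (u - 1 - (d - 2)) else 0) =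
      ∑ S ∈ s.powerset, if (#(insert a (insert b S)) : ℤ) = d ∧ Ad (insert a (insert b S))
        then colWeight x (insert a (insert b S)) u else 0 := by
    unfold colSum
    rw [mul_sum, sum_mul, ite_sum_zero]
    refine sum_congr rfl fun S hS => ?_
    rw [mem_powerset] at hS
    rw [card_insert_of_notMem fun h => has (insert_subset_insert b hS h),
      card_insert_of_notMem fun h => hbs (hS h), hAab S hS,
      colWeight_insert_min x _ a, colWeight_insert_max x S b fun j hj => (hs j (hS hj)).2]
    · by_cases h : (#S : ℤ) = d - 2
      · have h' : ((#S : ℕ) : ℂ) = (d : ℂ) - 2 := by exact_mod_cast congrArg (Int.cast : ℤ → ℂ) h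
        have h'' : d - 2 + 1 + 1 = d := by ring
        by_cases hC : C d <;> by_cases hA : Ad S <;> simp [h, h', h'', hC, hA, mul_assoc]
      · have h' : ¬ (#S : ℤ) + 1 + 1 = d := by omega
        simp [h, h']
    · intro j hj
      rcases mem_insert.1 hj with rfl | hj
      · exact hab
      · exact (hs j (hS hj)).1
  rw [key, key2, key3]
  conv_lhs => unfold colSum
  rw [sum_powerset_insert has, sum_powerset_insert hbs, sum_powerset_insert hbs, colSum]
  ring

/-- Strictly increasing fillings correspond to their sets of entries. -/
theorem sum_strictMono_eq_colSum (x : ℕ → ℂ → K) (Ad : Finset ℕ → Prop) (M a : ℕ)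
    (P : (Fin a → Fin M) → Prop)
    (hP : ∀ t : Fin a → Fin M, StrictMono t → (P t ↔ Ad (univ.image fun k => (t k : ℕ))))
    (u : ℂ) :
    ∑ t ∈ univ.filter (fun t : Fin a → Fin M => StrictMono t ∧ P t),
      ∏ k : Fin a, x (t k) (u - ((k : ℕ) : ℂ)) = colSum x Ad (range M) a u := by
  unfold colSum
  rw [← sum_filter]
  refine sum_nbij (fun t => univ.image fun k => (t k : ℕ)) ?_ ?_ ?_ ?_
  · intro t ht
    simp only [mem_filter, mem_univ, true_and] at ht
    have hinj : Function.Injective fun k => (t k : ℕ) :=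
      Fin.val_injective.comp ht.1.injective
    simp only [mem_filter, mem_powerset, card_image_of_injective _ hinj, card_univ,
      Fintype.card_fin, true_and]
    refine ⟨?_, (hP t ht.1).1 ht.2⟩
    intro i hi
    obtain ⟨k, -, rfl⟩ := mem_image.1 hi
    exact mem_range.2 (t k).2
  · intro t ht t' ht' h
    simp only [coe_filter, mem_univ, true_and, Set.mem_ofPred_eq] at ht ht'
    have h1 : StrictMono fun k => (t k : ℕ) := fun i j hij => ht.1 hij
    have h2 : StrictMono fun k => (t' k : ℕ) := fun i j hij => ht'.1 hij
    have h3 := (StrictMono.range_inj h1 h2).1 (by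
      have := congrArg (fun S : Finset ℕ => (S : Set ℕ)) h
      simpa using this)
    funext k
    exact Fin.ext (congrFun h3 k)
  · intro S hS
    simp only [coe_filter, mem_powerset, Set.mem_ofPred_eq, Nat.cast_inj] at hS
    obtain ⟨hsub, hc, hAd⟩ := hS
    have himg : (univ.image fun k => S.orderEmbOfFin hc k) = S := by
      apply coe_injective
      simp
    let t : Fin a → Fin M := fun k =>
      ⟨S.orderEmbOfFin hc k, mem_range.1 (hsub (S.orderEmbOfFin_mem hc k))⟩
    have ht : StrictMono t := fun i j hij => (S.orderEmbOfFin hc).strictMono hij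
    refine ⟨t, ?_, himg⟩
    simp only [coe_filter, mem_univ, true_and, Set.mem_ofPred_eq]
    refine ⟨ht, (hP t ht).2 ?_⟩
    change Ad (univ.image fun k => S.orderEmbOfFin hc k)
    rwa [himg]
  · intro t ht
    simp only [mem_filter, mem_univ, true_and] at ht
    have hinj : Function.Injective fun k => (t k : ℕ) :=
      Fin.val_injective.comp ht.1.injective
    unfold colWeight
    rw [prod_image fun i _ j _ h => hinj h]
    refine prod_congr rfl fun k _ => ?_
    rw [filter_image, card_image_of_injective _ hinj]
    have : ({j | (t j : ℕ) < t k} : Finset (Fin a)) = Iio k := by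
      ext j
      simp [ht.1.lt_iff_lt]
    rw [this, Fin.card_Iio]

/-- The reflection property of a sequence of coefficients built by the two-sided column recursion:
the coefficients of degrees `m + 1 + j` and `m + 1 - j` are opposite up to a product of units, and
the middle one vanishes. -/
theorem reflection_of_recursion (n : ℕ) (A B : ℕ → ℂ → K) (p : ℕ → ℤ → ℂ → K)
    (h0 : ∀ d u, p 0 d u =
      if d = 0 then 1 else if d = 2 then -(A 0 u * B 0 (u - 1)) else 0)
    (hp : ∀ m < n, ∀ d u, p (m + 1) d u = p m d u + A m u * p m (d - 1) (u - 1)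
      + p m (d - 1) u * B m (u - (d - 1)) + A m u * p m (d - 2) (u - 1) * B m (u - 1 - (d - 2)))
    (hAB : ∀ m, m + 1 < n → ∀ v : ℂ,
      A (m + 1) v * B (m + 1) (v - m - 2) = A m v * B m (v - m - 2)) :
    ∀ m < n, (∀ u, p m (m + 1) u = 0) ∧ ∀ (j : ℕ) (u : ℂ), p m (m + 1 + j) u =
      -((∏ i ∈ range j, A m (u - i) * B m (u - i - m - 1)) * p m (m + 1 - j) (u - j)) := by
  intro m
  induction m with
  | zero =>
    intro _
    refine ⟨fun u => by simp [h0], fun j u => ?_⟩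
    match j with
    | 0 => simp [h0]
    | 1 => simp [h0]
    | j + 2 =>
      have h1 : ¬ (1 + ((j : ℤ) + 2) = 0) := by omega
      have h2 : ¬ (1 + ((j : ℤ) + 2) = 2) := by omega
      have h3 : ¬ (1 - ((j : ℤ) + 2) = 0) := by omega
      have h4 : ¬ (1 - ((j : ℤ) + 2) = 2) := by omega
      simp [h0, h1, h2, h3, h4]
  | succ m ih =>
    intro hm
    obtain ⟨hz, hr⟩ := ih (by omega)
    let b : ℂ → K := fun v => B m (v - m - 1)
    have hr : ∀ (j : ℕ) (u : ℂ), p m (m + 1 + j) u =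
        -((∏ i ∈ range j, A m (u - i)) * (∏ i ∈ range j, b (u - i))
          * p m (m + 1 - j) (u - j)) := by
      intro j u
      rw [hr, prod_mul_distrib]
    have hleft : ∀ (f : ℂ → K) (k : ℕ) (v : ℂ),
        ∏ i ∈ range (k + 1), f (v - i) = f v * ∏ i ∈ range k, f (v - 1 - i) := by
      intro f k v
      rw [prod_range_succ', mul_comm]
      congr 1
      · simp
      · refine prod_congr rfl fun i _ => ?_
        congr 1
        push_cast; ring
    have hprod : ∀ (j : ℕ) (u : ℂ),
        ∏ i ∈ range j, A (m + 1) (u - i) * B (m + 1) (u - i - (m + 1 : ℕ) - 1) =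
          (∏ i ∈ range j, A m (u - i)) * ∏ i ∈ range j, b (u - 1 - i) := by
      intro j u
      rw [← prod_mul_distrib]
      refine prod_congr rfl fun i _ => ?_
      have h := hAB m hm (u - i)
      have e1 : u - i - (m + 1 : ℕ) - 1 = u - i - m - 2 := by push_cast; ring
      have e2 : u - 1 - i - m - 1 = u - i - m - 2 := by ring
      simp only [b]
      rw [e1, e2, h]
    have hz' : ∀ u, p (m + 1) ((m + 1 : ℕ) + 1) u = 0 := by
      intro u
      have h1 := hr 1 u
      rw [hp m (by omega)]
      push_cast at h1 ⊢
      rw [show (m : ℤ) + 1 + 1 - 1 = m + 1 by ring, hz, hz, h1,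
        show (m : ℤ) + 1 + 1 - 2 = m + 1 - 1 by ring]
      simp [b]
      ring_nf
    refine ⟨hz', fun j u => ?_⟩
    rw [hprod]
    rcases j with _ | j
    · simp only [Nat.cast_zero, add_zero, sub_zero, hz', mul_zero, neg_zero]
    have hr0 := hr j (u - 1)
    have hr1 := hr (j + 1) u
    have hr1' := hr (j + 1) (u - 1)
    have hr2 := hr (j + 2) u
    rw [prod_range_succ, prod_range_succ] at hr1'
    rw [hleft, hleft] at hr1
    rw [hleft (A m) (j + 1), hleft b (j + 1), prod_range_succ, prod_range_succ] at hr2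
    rw [hleft, prod_range_succ, hp m (by omega), hp m (by omega)]
    have e2 : u - 1 - j = u - ↑(j + 1) := by push_cast; ring
    have i2 : (m : ℤ) + 1 - j = ↑(m + 1) + 1 - ↑(j + 1) := by push_cast; ring
    have i1 : (m : ℤ) + 1 - ↑(j + 1) = ↑(m + 1) + 1 - ↑(j + 1) - 1 := by push_cast; ring
    have i0 : (m : ℤ) + 1 - ↑(j + 2) = ↑(m + 1) + 1 - ↑(j + 1) - 2 := by push_cast; ring
    have e1 : u - 1 - ↑(j + 1) = u - ↑(j + 1) - 1 := by ring
    have e0 : u - ↑(j + 2) = u - ↑(j + 1) - 1 := by push_cast; ring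
    rw [i2, e2] at hr0
    rw [i1] at hr1
    rw [i1, e1, e2] at hr1'
    rw [i0, e0, e2] at hr2
    have k2 : (↑(m + 1) + 1 + ↑(j + 1) : ℤ) = m + 1 + ↑(j + 2) := by push_cast; ring
    have k1 : (m + 1 + ↑(j + 2) - 1 : ℤ) = m + 1 + ↑(j + 1) := by push_cast; ring
    have k0 : (m + 1 + ↑(j + 2) - 2 : ℤ) = m + 1 + j := by push_cast; ring
    rw [k2, k1, k0, hr0, hr1, hr1', hr2, e2]
    have b1 : B m (u - ((m + 1 + ↑(j + 2) : ℤ) - 1)) = b (u - ↑(j + 1)) := by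
      simp only [b]; congr 1; push_cast; ring
    have b2 : B m (u - 1 - ((m + 1 + ↑(j + 2) : ℤ) - 2)) = b (u - ↑(j + 1)) := by
      simp only [b]; congr 1; push_cast; ring
    have b3 : B m (u - ↑(j + 1) - ((↑(m + 1) + 1 - ↑(j + 1) : ℤ) - 1)) = b u := by
      simp only [b]; congr 1; push_cast; ring
    have b4 : B m (u - ↑(j + 1) - 1 - ((↑(m + 1) + 1 - ↑(j + 1) : ℤ) - 2)) = b u := by
      simp only [b]; congr 1; push_cast; ring
    rw [b1, b2, b3, b4]
    ring

/-- The two-sided column recursion and its truncation to admissible columns agree up to the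
middle degree. -/
theorem truncated_recursion_eq (n : ℕ) (A B : ℕ → ℂ → K) (p r : ℕ → ℤ → ℂ → K)
    (h0 : ∀ d u, p 0 d u =
      if d = 0 then 1 else if d = 2 then -(A 0 u * B 0 (u - 1)) else 0)
    (hp : ∀ m < n, ∀ d u, p (m + 1) d u = p m d u + A m u * p m (d - 1) (u - 1)
      + p m (d - 1) u * B m (u - (d - 1)) + A m u * p m (d - 2) (u - 1) * B m (u - 1 - (d - 2)))
    (hAB : ∀ m, m + 1 < n → ∀ v : ℂ,
      A (m + 1) v * B (m + 1) (v - m - 2) = A m v * B m (v - m - 2))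
    (hr0 : ∀ d u, r 0 d u = if d = 0 then 1 else 0)
    (hr : ∀ m < n, ∀ d u, r (m + 1) d u = r m d u + A m u * r m (d - 1) (u - 1)
      + r m (d - 1) u * B m (u - (d - 1))
      + if d ≤ m + 1 then A m u * r m (d - 2) (u - 1) * B m (u - 1 - (d - 2)) else 0) :
    ∀ m ≤ n, (∀ d > (m : ℤ), ∀ u, r m d u = 0) ∧ ∀ d ≤ (m : ℤ), ∀ u, r m d u = p m d u := by
  intro m
  induction m with
  | zero =>
    refine fun _ => ⟨fun d hd u => ?_, fun d hd u => ?_⟩ <;> simp only [hr0, h0] <;> grind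
  | succ m ih =>
    intro hm
    obtain ⟨hgt, hle⟩ := ih (by omega)
    have hz := (reflection_of_recursion n A B p h0 hp hAB m (by omega)).1
    push_cast
    refine ⟨fun d hd u => ?_, fun d hd u => ?_⟩
    · rw [hr m (by omega), hgt d (by omega), hgt (d - 1) (by omega), hgt (d - 1) (by omega),
        if_neg (by omega)]
      ring
    · have hd' : r m d u = p m d u := by
        rcases hd.eq_or_lt with rfl | h
        · rw [hgt _ (by omega), hz]
        · exact hle d (by omega) u
      rw [hr m (by omega), hp m (by omega), hd', hle (d - 1) (by omega), hle (d - 1) (by omega),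
        hle (d - 2) (by omega), if_pos hd]

/-- Admissibility of a set of (`0`-based) letters. -/
def AdmSet (n : ℕ) (S : Finset ℕ) : Prop :=
  ∀ i ∈ S, i < n → 2 * n - 1 - i ∈ S → i + 1 + #{j ∈ S | i ≤ j ∧ j < 2 * n - 1 - i} ≤ n

theorem admQ_iff_admSet (n a : ℕ) (t : Fin a → Fin (2 * n)) (ht : StrictMono t) :
    AdmQ n t ↔ AdmSet n (univ.image fun k => (t k : ℕ)) := by
  have hinj : Function.Injective fun k => (t k : ℕ) := Fin.val_injective.comp ht.injective
  have hcard : ∀ k l : Fin a, #{j ∈ univ.image (fun k => (t k : ℕ)) | (t k : ℕ) ≤ j ∧ j < t l} =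
      (l : ℕ) - k := by
    intro k l
    rw [filter_image, card_image_of_injective _ hinj]
    have : ({j | (t k : ℕ) ≤ t j ∧ (t j : ℕ) < t l} : Finset (Fin a)) = Ico k l := by
      ext j
      simp [ht.lt_iff_lt, ht.le_iff_le]
    rw [this, Fin.card_Ico]
  constructor
  · intro h i hi hin hc
    obtain ⟨k, -, rfl⟩ := mem_image.1 hi
    obtain ⟨l, -, hl⟩ := mem_image.1 hc
    have := h k l (by omega) (by omega)
    rw [← hl, hcard]
    omega
  · intro h k l hk hl
    have hl' : 2 * n - 1 - (t k : ℕ) = t l := by omega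
    have := h (t k) (mem_image_of_mem _ (mem_univ k)) (by omega)
      (hl' ▸ mem_image_of_mem _ (mem_univ l))
    rw [hl', hcard] at this
    omega

theorem admSet_insert_of_conj_notMem (n : ℕ) (S : Finset ℕ) (a m : ℕ) (hm : m < n)
    (hS : S ⊆ Ico (n - m) (n + m)) (ha : a = n - 1 - m ∨ a = n + m) :
    AdmSet n (insert a S) ↔ AdmSet n S := by
  have hmem : ∀ j ∈ S, n - m ≤ j ∧ j < n + m := fun j hj => mem_Ico.1 (hS hj)
  have hcount : ∀ i ∈ S, i < n → ({j ∈ insert a S | i ≤ j ∧ j < 2 * n - 1 - i} : Finset ℕ) =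
      {j ∈ S | i ≤ j ∧ j < 2 * n - 1 - i} := by
    intro i hi hin
    have := hmem i hi
    rw [filter_insert, if_neg (by omega)]
  constructor
  · intro h i hi hin hc
    rw [← hcount i hi hin]
    exact h i (mem_insert_of_mem hi) hin (mem_insert_of_mem hc)
  · intro h i hi hin hc
    rcases mem_insert.1 hi with rfl | hi
    · rcases mem_insert.1 hc with hc | hc
      · omega
      · have := hmem _ hc
        omega
    · have := hmem i hi
      rw [hcount i hi hin]
      refine h i hi hin ((mem_insert.1 hc).resolve_left ?_)
      omega

theorem admSet_insert_insert (n : ℕ) (S : Finset ℕ) (m : ℕ) (hm : m < n)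
    (hS : S ⊆ Ico (n - m) (n + m)) :
    AdmSet n (insert (n - 1 - m) (insert (n + m) S)) ↔
      AdmSet n S ∧ ((#S : ℤ) + 2 ≤ m + 1) := by
  have hmem : ∀ j ∈ S, n - m ≤ j ∧ j < n + m := fun j hj => mem_Ico.1 (hS hj)
  have hcount : ∀ i ∈ S, i < n → ({j ∈ insert (n - 1 - m) (insert (n + m) S) |
      i ≤ j ∧ j < 2 * n - 1 - i} : Finset ℕ) = {j ∈ S | i ≤ j ∧ j < 2 * n - 1 - i} := by
    intro i hi hin
    have := hmem i hi
    rw [filter_insert, if_neg (by omega), filter_insert, if_neg (by omega)]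
  have hnot : n - 1 - m ∉ S := fun h => by have := hmem _ h; omega
  have hconj : 2 * n - 1 - (n - 1 - m) = n + m := by omega
  have houter : #{j ∈ insert (n - 1 - m) (insert (n + m) S) |
      n - 1 - m ≤ j ∧ j < 2 * n - 1 - (n - 1 - m)} = #S + 1 := by
    rw [filter_insert, if_pos (by omega), filter_insert, if_neg (by omega),
      filter_true_of_mem, card_insert_of_notMem hnot]
    intro j hj
    have := hmem j hj
    omega
  constructor
  · intro h
    refine ⟨fun i hi hin hc => ?_, ?_⟩
    · rw [← hcount i hi hin]
      exact h i (mem_insert_of_mem (mem_insert_of_mem hi)) hin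
        (mem_insert_of_mem (mem_insert_of_mem hc))
    · have := h (n - 1 - m) (mem_insert_self _ _) (by omega) (by simp [hconj])
      rw [houter] at this
      omega
  · rintro ⟨h, hle⟩ i hi hin hc
    rcases mem_insert.1 hi with rfl | hi
    · rw [houter]
      omega
    rcases mem_insert.1 hi with rfl | hi
    · omega
    have := hmem i hi
    rw [hcount i hi hin]
    exact h i hi hin ((mem_insert.1 ((mem_insert.1 hc).resolve_left (by omega))).resolve_left
      (by omega))

theorem zq_mul_zq_conj (n : ℕ) (Q : ℕ → ℂ → Kˣ) (m : ℕ) (hm : m + 1 < n) (v : ℂ) :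
    zq n Q (n - (m + 1)) v * zq n Q (n + 1 + (m + 1)) (v - m - 2) =
      zq n Q (n - m) v * zq n Q (n + 1 + m) (v - m - 2) := by
  obtain ⟨c, rfl⟩ : ∃ c, n = c + 1 + (m + 1) := ⟨n - (m + 2), by omega⟩
  unfold zq
  rw [if_pos (by omega), if_neg (by omega), if_pos (by omega), if_neg (by omega)]
  have e1 : c + 1 + (m + 1) - (m + 1) = c + 1 := by omega
  have e2 : c + 1 + (m + 1) - m = c + 2 := by omega
  have e3 : 2 * (c + 1 + (m + 1)) - (c + 1 + (m + 1) + 1 + (m + 1)) = c := by omega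
  have e4 : 2 * (c + 1 + (m + 1)) + 1 - (c + 1 + (m + 1) + 1 + (m + 1)) = c + 1 := by omega
  have e5 : 2 * (c + 1 + (m + 1)) - (c + 1 + (m + 1) + 1 + m) = c + 1 := by omega
  have e6 : 2 * (c + 1 + (m + 1)) + 1 - (c + 1 + (m + 1) + 1 + m) = c + 2 := by omega
  have e7 : c + 1 - 1 = c := by omega
  have e8 : c + 2 - 1 = c + 1 := by omega
  rw [e1, e2, e3, e4, e5, e6, e7, e8]
  push_cast
  have f1 : v - m - 2 + ((c : ℂ) + 1 + (m + 1) + 1 + (m + 1) + 2) / 2 = v + (c + 1 + 1) / 2 := by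
    ring
  have f2 : v - m - 2 + ((c : ℂ) + 1 + (m + 1) + 1 + (m + 1) + 3) / 2 = v + (c + 2 + 1) / 2 := by
    ring
  have f3 : v - m - 2 + ((c : ℂ) + 1 + (m + 1) + 1 + m + 2) / 2 = v + (c + 1) / 2 := by ring
  have f4 : v - m - 2 + ((c : ℂ) + 1 + (m + 1) + 1 + m + 3) / 2 = v + (c + 2) / 2 := by ring
  rw [f1, f2, f3, f4, mul_assoc, inv_mul_cancel_left, mul_comm (_ * _) (_ * _), mul_assoc,
    inv_mul_cancel_left]

theorem xqmid_mul_xqmid (n : ℕ) (hn : 1 ≤ n) (Q : ℕ → ℂ → Kˣ) (v : ℂ) :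
    xqmid n Q v * xqmid n Q (v - 1) = (zq n Q n v : K) * zq n Q (n + 1) (v - 1) := by
  have hY : zq n Q n v * zq n Q (n + 1) (v - 1) =
      Yq n Q n (v + n / 2) * (Yq n Q n (v + (n + 2) / 2))⁻¹ := by
    unfold zq
    rw [if_pos le_rfl, if_neg (by omega)]
    have e1 : 2 * n - (n + 1) = n - 1 := by omega
    have e2 : 2 * n + 1 - (n + 1) = n := by omega
    rw [e1, e2]
    push_cast
    have f1 : v - 1 + ((n : ℂ) + 1 + 2) / 2 = v + (n + 1) / 2 := by ring
    have f2 : v - 1 + ((n : ℂ) + 1 + 3) / 2 = v + (n + 2) / 2 := by ring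
    rw [f1, f2, mul_assoc, inv_mul_cancel_left]
  have hx : ∀ w, xqmid n Q w = ((Q n (w + n / 2) * Q n (w + (n + 4) / 2) *
      (Q n (w + (n + 2) / 2))⁻¹ ^ 2 : Kˣ) : K) := fun w => by simp [xqmid]
  rw [hx, hx, ← Units.val_mul, ← Units.val_mul, hY]
  congr 1
  unfold Yq
  simp only [show n ≠ 0 by omega, if_false, if_true]
  have g1 : v - 1 + ((n : ℂ) + 4) / 2 = v + (n + 2) / 2 := by ring
  have g2 : v - 1 + ((n : ℂ) + 2) / 2 = v + n / 2 := by ring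
  have g3 : v + (n : ℂ) / 2 - 1 = v - 1 + n / 2 := by ring
  have g4 : v + (n : ℂ) / 2 + 1 = v + (n + 2) / 2 := by ring
  have g5 : v + ((n : ℂ) + 2) / 2 - 1 = v + n / 2 := by ring
  have g6 : v + ((n : ℂ) + 2) / 2 + 1 = v + (n + 4) / 2 := by ring
  rw [g1, g2, g3, g4, g5, g6]
  generalize Q n (v + n / 2) = q0
  generalize Q n (v + (n + 2) / 2) = q1
  generalize Q n (v + (n + 4) / 2) = q2
  generalize Q n (v - 1 + n / 2) = q3
  calc q0 * q2 * q1⁻¹ ^ 2 * (q3 * q1 * q0⁻¹ ^ 2)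
      = q3 * q1⁻¹ * (q2 * q0⁻¹) * (q1 * q1⁻¹) * (q0 * q0⁻¹) := by
        simp only [pow_two]
        ac_rfl
    _ = q3 * q1⁻¹ * (q0 * q2⁻¹)⁻¹ := by simp

theorem Ico_eq_insert_insert (l h : ℕ) (hl : 1 ≤ l) (hlh : l ≤ h) :
    Ico (l - 1) (h + 1) = insert (l - 1) (insert h (Ico l h)) := by
  ext i
  simp only [mem_Ico, mem_insert]
  omega

/-- The column sums over the `2m + 2` middle letters obey the two-sided recursion. -/
theorem colSum_xq_succ (n : ℕ) (Q : ℕ → ℂ → Kˣ) (m : ℕ) (hm : m < n) (d : ℤ) (u : ℂ) :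
    let p : ℕ → ℤ → ℂ → K := fun m => colSum (fun i => xq n Q (i + 1)) (fun _ => True)
      (Ico (n - m) (n + 2 + m))
    p (m + 1) d u = p m d u + zq n Q (n - m) u * p m (d - 1) (u - 1)
      + p m (d - 1) u * zq n Q (n + 1 + m) (u - (d - 1))
      + zq n Q (n - m) u * p m (d - 2) (u - 1) * zq n Q (n + 1 + m) (u - 1 - (d - 2)) := by
  intro p
  have hx : ∀ v, xq n Q (n - m - 1 + 1) v = zq n Q (n - m) v := fun v => by
    rw [xq, if_pos (by omega), show n - m - 1 + 1 = n - m by omega]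
  have hx' : ∀ v, xq n Q (n + 2 + m + 1) v = zq n Q (n + 1 + m) v := fun v => by
    rw [xq, if_neg (by omega), if_neg (by omega), if_neg (by omega),
      show n + 2 + m + 1 - 2 = n + 1 + m by omega]
  have h := colSum_insert_insert (fun i => xq n Q (i + 1)) (fun _ => True)
    (Ico (n - m) (n + 2 + m)) (n - m - 1) (n + 2 + m) (by omega)
    (fun j hj => by rw [mem_Ico] at hj; omega) (fun _ => True) (by simp) (by simp) (by simp) d u
  rw [← Ico_eq_insert_insert _ _ (by omega) (by omega), if_pos trivial, hx, hx', hx'] at h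
  exact h

/-- The admissible column sums over the `2m` middle letters obey the truncated recursion. -/
theorem colSum_zq_succ (n : ℕ) (Q : ℕ → ℂ → Kˣ) (m : ℕ) (hm : m < n) (d : ℤ) (u : ℂ) :
    let r : ℕ → ℤ → ℂ → K := fun m => colSum (fun i v => (zq n Q (i + 1) v : K)) (AdmSet n)
      (Ico (n - m) (n + m))
    r (m + 1) d u = r m d u + zq n Q (n - m) u * r m (d - 1) (u - 1)
      + r m (d - 1) u * zq n Q (n + 1 + m) (u - (d - 1))
      + if d ≤ m + 1 then
          zq n Q (n - m) u * r m (d - 2) (u - 1) * zq n Q (n + 1 + m) (u - 1 - (d - 2))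
        else 0 := by
  intro r
  have e : n - 1 - m = n - m - 1 := by omega
  have h := colSum_insert_insert (fun i v => (zq n Q (i + 1) v : K)) (AdmSet n)
    (Ico (n - m) (n + m)) (n - m - 1) (n + m) (by omega)
    (fun j hj => by rw [mem_Ico] at hj; omega) (fun d => d ≤ m + 1)
    (fun S hS => admSet_insert_of_conj_notMem n S _ m hm hS (by omega))
    (fun S hS => admSet_insert_of_conj_notMem n S _ m hm hS (by omega))
    (fun S hS => e ▸ admSet_insert_insert n S m hm hS) d u
  rw [← Ico_eq_insert_insert _ _ (by omega) (by omega)] at h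
  simp only [show n - m - 1 + 1 = n - m by omega, show n + m + 1 = n + 1 + m by omega] at h
  rw [← h, show n + 1 + m = n + (m + 1) by omega]
  rfl

/-- The column sums over the two opposite middle letters. -/
theorem colSum_xq_zero (n : ℕ) (hn : 1 ≤ n) (Q : ℕ → ℂ → Kˣ) (d : ℤ) (u : ℂ) :
    colSum (fun i => xq n Q (i + 1)) (fun _ => True) (Ico n (n + 2)) d u =
      if d = 0 then 1 else if d = 2 then -((zq n Q n u : K) * zq n Q (n + 1) (u - 1)) else 0 := by
  have hI : Ico n (n + 2) = insert n (insert (n + 1) ∅) := by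
    ext i
    simp only [mem_Ico, mem_insert, notMem_empty, or_false]
    omega
  have hx : ∀ v, xq n Q (n + 1) v = xqmid n Q v := fun v => by simp [xq]
  have hx' : ∀ v, xq n Q (n + 1 + 1) v = -xqmid n Q v := fun v => by simp [xq]
  have h0 : ∀ (d : ℤ) (v : ℂ), colSum (fun i => xq n Q (i + 1)) (fun _ => True) ∅ d v =
      if d = 0 then 1 else 0 := fun d v => by simp [colSum, colWeight, eq_comm]
  rw [hI, colSum_insert_insert _ _ ∅ n (n + 1) (by omega) (by simp) (fun _ => True)
    (by simp) (by simp) (by simp), ← xqmid_mul_xqmid n hn]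
  simp only [h0, hx, hx', if_true]
  by_cases hd0 : d = 0
  · simp [hd0]
  by_cases hd1 : d = 1
  · simp [hd1]
  by_cases hd2 : d = 2
  · simp [hd2]
  · have h1 : ¬ d - 1 = 0 := by omega
    have h2 : ¬ d - 2 = 0 := by omega
    simp [hd0, hd2, h1, h2]

/-- Proposition 2.4 (canceling tableau sums): for `1 ≤ a ≤ n`,
`T^{(a)}_1(u) = ∑_{1 ≤ i_1 < ⋯ < i_a ≤ N} ∏_{k=1}^a x_{i_k}(u + a/2 - k)`. -/
theorem statement3 {K : Type*} [CommRing K] (n : ℕ) (hn : 2 ≤ n) (Q : ℕ → ℂ → Kˣ)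
    (a : ℕ) (ha1 : 1 ≤ a) (ha2 : a ≤ n) (u : ℂ) :
    T1q n Q a u =
      ∑ t ∈ Finset.univ.filter (fun t : Fin a → Fin (2 * n + 2) => StrictMono t),
        ∏ k : Fin a,
          xq n Q ((t k : ℕ) + 1) (u + (a : ℂ) / 2 - (((k : ℕ) : ℂ) + 1)) := by
  have hr := (truncated_recursion_eq n (fun m v => (zq n Q (n - m) v : K))
    (fun m v => (zq n Q (n + 1 + m) v : K))
    (fun m => colSum (fun i => xq n Q (i + 1)) (fun _ => True) (Ico (n - m) (n + 2 + m)))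
    (fun m => colSum (fun i v => (zq n Q (i + 1) v : K)) (AdmSet n) (Ico (n - m) (n + m)))
    (colSum_xq_zero n (by omega) Q) (colSum_xq_succ n Q)
    (fun m hm v => by exact_mod_cast congrArg Units.val (zq_mul_zq_conj n Q m hm v))
    (fun d u => by simp [colSum, colWeight, AdmSet, eq_comm])
    (colSum_zq_succ n Q) n le_rfl).2 a (by exact_mod_cast ha2) (u + a / 2 - 1)
  simp only [Nat.sub_self, ← range_eq_Ico] at hr
  rw [show n + n = 2 * n by ring, show n + 2 + n = 2 * n + 2 by ring,
    ← sum_strictMono_eq_colSum _ _ _ _ (AdmQ n) (admQ_iff_admSet n a),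
    ← sum_strictMono_eq_colSum _ _ _ _ (fun _ => True) (fun _ _ => Iff.rfl)] at hr
  rw [T1q, if_neg (by omega), if_pos (by exact_mod_cast ha2), Int.toNat_natCast, tabSumQ]
  simp only [and_true] at hr
  have e : ∀ k : Fin a, u + ((a : ℂ) - 2 * (((k : ℕ) : ℂ) + 1)) / 2 =
      u + a / 2 - 1 - ((k : ℕ) : ℂ) := fun k => by ring
  have e' : ∀ k : Fin a, u + (a : ℂ) / 2 - (((k : ℕ) : ℂ) + 1) =
      u + a / 2 - 1 - ((k : ℕ) : ℂ) := fun k => by ring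
  simp only [e, e']
  exact hr
end
end

section
/- Jacobi-Trudi type formula for hook shapes: for every 0 ≤ i ≤ N−1 and u ∈ ℂ: (a) if 0 ≤ k ≤ N−1 then H^{(i)}_k(u + i/2) = (−1)^i δ_{i,k}; (b) if k ≥ N then H^{(i)}_k(u + i/2) = −det_{1 ≤ j,l ≤ k−N+1}( T^{(λ'_j − j + l)}_1(u + (N − 2 − λ'_j + j + l)/2) ), where λ'_1 = N − i and λ'_j = 1 for 2 ≤ j ≤ k−N+1. -/
attribute [local instance 10] Classical.propDecidable

noncomputable section

open Finset

variable {K : Type*} [CommRing K]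

/-- `H^{(i)}_k`, defined by `H^{(i)}_0(u) = δ_{i,0}` and the recursion
`H^{(i)}_{k+1}(u+i/2) = -T^{(i)}_1(u+i/2) H^{(N-1)}_k(u+(N+1)/2) - H^{(i-1)}_k(u+(i+1)/2)`,
with the convention `H^{(-1)}_k = 0`. -/
def Hq (n : ℕ) (Q : ℕ → ℂ → Kˣ) : ℕ → ℕ → ℂ → K
  | i, 0 => fun _ => if i = 0 then 1 else 0
  | i, k + 1 => fun v =>
      -T1q n Q i v * Hq n Q (2 * n + 1) k (v + (2 * (n : ℂ) + 3 - (i : ℂ)) / 2) -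
        if i = 0 then 0 else Hq n Q (i - 1) k (v + 2⁻¹)

/-- the Jacobi-Trudi matrix, of size `m + 1`, of the hook with column heights `p, 1, …, 1`. -/
def hookMatrix (n : ℕ) (T : ℤ → ℂ → K) (p m : ℕ) (u : ℂ) : Matrix (Fin (m + 1)) (Fin (m + 1)) K :=
  Matrix.of fun j l =>
    T (((if (j : ℕ) = 0 then p else 1 : ℕ) : ℤ) - (j : ℕ) + (l : ℕ))
      (u + ((2 * n + 2 : ℂ) + ((j : ℕ) : ℂ) + ((l : ℕ) : ℂ) -
        ((if (j : ℕ) = 0 then p else 1 : ℕ) : ℂ)) / 2)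

theorem det_hookMatrix_zero (n : ℕ) (T : ℤ → ℂ → K) (p : ℕ) (u : ℂ) :
    (hookMatrix n T p 0 u).det = T p (u + ((2 * n + 2 : ℂ) - p) / 2) := by
  simp [hookMatrix]

/-- The hook determinant vanishes when its first column is too tall. -/
theorem det_hookMatrix_eq_zero (n : ℕ) (T : ℤ → ℂ → K) (p m : ℕ) (u : ℂ)
    (hT : ∀ a v, (p : ℤ) ≤ a → T a v = 0) : (hookMatrix n T p m u).det = 0 := by
  apply Matrix.det_eq_zero_of_row_eq_zero 0
  intro l
  simp only [hookMatrix, Matrix.of_apply]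
  exact hT _ _ (by simp)

/-- Expansion of the hook determinant along its first column. -/
theorem det_hookMatrix_succ (n : ℕ) (T : ℤ → ℂ → K) (p m : ℕ) (u : ℂ)
    (h0 : ∀ v, T 0 v = 1) (hneg : ∀ a v, a < 0 → T a v = 0) :
    (hookMatrix n T p (m + 1) u).det =
      T p (u + ((2 * n + 2 : ℂ) - p) / 2) * (hookMatrix n T 1 m (u + 1)).det -
        (hookMatrix n T (p + 1) m (u + 1)).det := by
  have hminor : (hookMatrix n T p (m + 1) u).submatrix (Fin.succAbove 0) Fin.succ =
      hookMatrix n T 1 m (u + 1) := by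
    ext j l
    simp only [hookMatrix, Matrix.of_apply, Matrix.submatrix_apply, Fin.succAbove_zero,
      Fin.val_succ, ite_self, Nat.succ_ne_zero, if_false]
    congr 1
    · push_cast; ring
    · push_cast; ring
  have hminor' : (hookMatrix n T p (m + 1) u).submatrix (Fin.succAbove 1) Fin.succ =
      hookMatrix n T (p + 1) m (u + 1) := by
    ext j l
    refine Fin.cases ?_ (fun j => ?_) j
    · simp only [hookMatrix, Matrix.of_apply, Matrix.submatrix_apply, Fin.one_succAbove_zero,
        Fin.val_succ, Fin.val_zero, if_true]
      congr 1
      · push_cast; ring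
      · push_cast; ring
    · simp only [hookMatrix, Matrix.of_apply, Matrix.submatrix_apply, Fin.one_succAbove_succ,
        Fin.val_succ, Nat.succ_ne_zero, if_false]
      congr 1
      · push_cast; ring
      · push_cast; ring
  have htail : ∀ j : Fin m, hookMatrix n T p (m + 1) u j.succ.succ 0 = 0 := by
    intro j
    simp only [hookMatrix, Matrix.of_apply]
    apply hneg
    simp
    omega
  have hzero : hookMatrix n T p (m + 1) u 0 0 = T p (u + ((2 * n + 2 : ℂ) - p) / 2) := by
    simp [hookMatrix]
  have hone : hookMatrix n T p (m + 1) u 1 0 = 1 := by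
    simp [hookMatrix, h0]
  rw [Matrix.det_succ_column_zero, Fin.sum_univ_succ, Fin.sum_univ_succ,
    Finset.sum_eq_zero fun j _ => by rw [htail]; ring, hminor, Fin.succ_zero_eq_one, hminor',
    hzero, hone]
  simp
  ring

theorem tabSumQ_zero (n : ℕ) (Q : ℕ → ℂ → Kˣ) (v : ℂ) : tabSumQ n Q 0 v = 1 := by
  rw [tabSumQ, filter_true_of_mem fun t _ => ⟨fun k => k.elim0, fun k => k.elim0⟩]
  simp

theorem T1q_zero (n : ℕ) (Q : ℕ → ℂ → Kˣ) (v : ℂ) : T1q n Q 0 v = 1 := by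
  simp [T1q, tabSumQ_zero]

theorem T1q_of_neg (n : ℕ) (Q : ℕ → ℂ → Kˣ) (a : ℤ) (v : ℂ) (ha : a < 0) : T1q n Q a v = 0 := by
  simp [T1q, ha]

theorem T1q_of_gt (n : ℕ) (Q : ℕ → ℂ → Kˣ) (a : ℤ) (v : ℂ) (ha : 2 * (n : ℤ) + 3 ≤ a) :
    T1q n Q a v = 0 := by
  rw [T1q, if_neg (by omega), if_neg (by omega), if_neg (by omega), if_neg (by omega)]

theorem T1q_compl (n : ℕ) (Q : ℕ → ℂ → Kˣ) (i : ℕ) (hi : i ≤ 2 * n + 2) (v : ℂ) :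
    T1q n Q ((2 * n + 2 - i : ℕ) : ℤ) v = -T1q n Q i v := by
  unfold T1q
  rcases lt_trichotomy i (n + 1) with h | h | h
  · rw [if_neg (by omega), if_neg (by omega), if_neg (by omega), if_pos (by omega),
      if_neg (by omega), if_pos (by omega)]
    congr 2
    omega
  · rw [if_neg (by omega), if_neg (by omega), if_pos (by omega), if_neg (by omega),
      if_neg (by omega), if_pos (by omega), neg_zero]
  · rw [if_neg (by omega), if_pos (by omega), if_neg (by omega), if_neg (by omega),
      if_neg (by omega), if_pos (by omega), neg_neg]
    congr 1
    omega

theorem Hq_succ (n : ℕ) (Q : ℕ → ℂ → Kˣ) (i k : ℕ) (u : ℂ) :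
    Hq n Q i (k + 1) (u + (i : ℂ) / 2) =
      -T1q n Q i (u + (i : ℂ) / 2) *
          Hq n Q (2 * n + 1) k (u + 1 + ((2 * n + 1 : ℕ) : ℂ) / 2) -
        if i = 0 then 0 else Hq n Q (i - 1) k (u + 1 + ((i - 1 : ℕ) : ℂ) / 2) := by
  have hlast : u + (i : ℂ) / 2 + (2 * (n : ℂ) + 3 - (i : ℂ)) / 2 =
      u + 1 + ((2 * n + 1 : ℕ) : ℂ) / 2 := by
    push_cast
    ring
  simp only [Hq, hlast]
  rcases i with _ | i
  · simp
  · have hprev : u + ((i + 1 : ℕ) : ℂ) / 2 + 2⁻¹ = u + 1 + ((i + 1 - 1 : ℕ) : ℂ) / 2 := by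
      rw [Nat.add_sub_cancel]
      push_cast
      ring
    rw [hprev]

theorem Hq_of_lt (n : ℕ) (Q : ℕ → ℂ → Kˣ) (i k : ℕ) (u : ℂ) (hk : k ≤ 2 * n + 1) :
    Hq n Q i k (u + (i : ℂ) / 2) = (-1 : K) ^ i * (if i = k then 1 else 0) := by
  induction k generalizing i u with
  | zero =>
    rw [Hq]
    by_cases h : i = 0 <;> simp [h]
  | succ k ih =>
    rw [Hq_succ, ih _ _ (by omega), ih _ _ (by omega), if_neg (by omega)]
    rcases i with _ | i
    · simp
    · by_cases h : i = k <;> simp [h, pow_succ]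

theorem Hq_eq_neg_det (n : ℕ) (Q : ℕ → ℂ → Kˣ) (i m : ℕ) (hi : i ≤ 2 * n + 1) (u : ℂ) :
    Hq n Q i (2 * n + 2 + m) (u + (i : ℂ) / 2) =
      -(hookMatrix n (T1q n Q) (2 * n + 2 - i) m u).det := by
  have harg : ∀ j : ℕ, j ≤ 2 * n + 1 → ∀ v : ℂ,
      v + ((2 * n + 2 : ℂ) - ((2 * n + 2 - j : ℕ) : ℂ)) / 2 = v + (j : ℂ) / 2 := by
    intro j hj v
    rw [Nat.cast_sub (by omega)]
    push_cast
    ring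
  induction m generalizing i u with
  | zero =>
    rw [det_hookMatrix_zero, harg i hi, T1q_compl n Q i (by omega), add_zero, Hq_succ,
      Hq_of_lt _ _ _ _ _ le_rfl, Hq_of_lt _ _ _ _ _ le_rfl, if_pos rfl,
      if_neg (by omega : i - 1 ≠ 2 * n + 1)]
    simp [pow_succ, pow_mul]
  | succ m ih =>
    rw [det_hookMatrix_succ _ _ _ _ _ (T1q_zero n Q) (T1q_of_neg n Q), harg i hi,
      T1q_compl n Q i (by omega), ← add_assoc, Hq_succ, ih _ le_rfl,
      (by omega : 2 * n + 2 - (2 * n + 1) = 1)]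
    rcases i with _ | i
    · rw [det_hookMatrix_eq_zero n _ (2 * n + 2 - 0 + 1) _ _
        fun a v ha => T1q_of_gt n Q a v (by omega)]
      simp
    · rw [if_neg (by omega), ih _ (by omega), (by omega : 2 * n + 2 - (i + 1) + 1 =
        2 * n + 2 - (i + 1 - 1))]
      ring

/-- Proposition 3.1 (Jacobi-Trudi type formula for hook shapes): for `0 ≤ i ≤ N-1`,
`H^{(i)}_k(u+i/2) = (-1)^i δ_{i,k}` for `0 ≤ k ≤ N-1`, and for `k ≥ N`,
`H^{(i)}_k(u+i/2) = -det_{1≤j,l≤k-N+1}(T^{(λ'_j-j+l)}_1(u+(N-2-λ'_j+j+l)/2))`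
where `λ'_1 = N-i` and `λ'_j = 1` for `j ≥ 2`. -/
theorem statement8 {K : Type*} [CommRing K] (n : ℕ) (hn : 2 ≤ n) (Q : ℕ → ℂ → Kˣ)
    (i k : ℕ) (hi : i ≤ 2 * n + 1) (u : ℂ) :
    (k ≤ 2 * n + 1 →
      Hq n Q i k (u + (i : ℂ) / 2) = (-1 : K) ^ i * (if i = k then 1 else 0)) ∧
    (2 * n + 2 ≤ k →
      Hq n Q i k (u + (i : ℂ) / 2) =
        -Matrix.det (Matrix.of fun j l : Fin (k - (2 * n + 2) + 1) =>
          T1q n Q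
            (((if (j : ℕ) = 0 then 2 * n + 2 - i else 1 : ℕ) : ℤ) - (j : ℕ) + (l : ℕ))
            (u + ((2 * n + 2 : ℂ) + ((j : ℕ) : ℂ) + ((l : ℕ) : ℂ) -
              ((if (j : ℕ) = 0 then 2 * n + 2 - i else 1 : ℕ) : ℂ)) / 2))) := by
  refine ⟨Hq_of_lt n Q i k u, fun hk => ?_⟩
  have h := Hq_eq_neg_det n Q i (k - (2 * n + 2)) hi u
  rwa [Nat.add_sub_cancel' hk] at h
end
end
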